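/- Let G be a connected finite simple graph, let S be the set of simplicial vertices of G, and suppose S is nonempty and χ_D(G) > χ_D(G − S), where G − S is the subgraph of G induced on V(G) \ S. Then either χ_D(G) ≤ Δ(G), or G is a complete multipartite graph that has a universal vertex. -/

import Mathlib

open SimpleGraph

/-- A proper colouring `c` of `G` is distinguishing if the identity is the only
automorphism of `G` preserving `c`. -/
def SimpleGraph.IsDistinguishingColoring {V α : Type*} (G : SimpleGraph V)
    (c : G.Coloring α) : Prop :=
  ∀ φ : G ≃g G, (∀ v, c (φ v) = c v) → ∀ v, φ v = v

/-- The distinguishing chromatic number of `G`: the least `k` such that `G` has a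
proper vertex colouring with `k` colours preserved only by the identity automorphism. -/
noncomputable def SimpleGraph.distChromNum {V : Type*} (G : SimpleGraph V) : ℕ :=
  sInf {k | ∃ c : G.Coloring (Fin k), G.IsDistinguishingColoring c}

/-- The maximum degree of `G`, stated without decidability assumptions. -/
noncomputable def SimpleGraph.maxDeg {V : Type*} [Fintype V] (G : SimpleGraph V) : ℕ := by
  classical exact G.maxDegree

/-- `G` contains no induced subgraph isomorphic to `H`. -/
def SimpleGraph.IsFreeOf {V W : Type*} (G : SimpleGraph V) (H : SimpleGraph W) : Prop :=
  ¬ Nonempty (H ↪g G)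

/-- A vertex is simplicial if its neighbourhood is a clique. -/
def SimpleGraph.IsSimplicialVertex {V : Type*} (G : SimpleGraph V) (v : V) : Prop :=
  G.IsClique (G.neighborSet v)

/-- `G` is complete multipartite: the vertex set can be partitioned into independent
sets (the classes of an equivalence relation) such that two vertices are adjacent
exactly when they lie in different parts. -/
def SimpleGraph.IsCompleteMultipartite' {V : Type*} (G : SimpleGraph V) : Prop :=
  ∃ r : V → V → Prop, Equivalence r ∧ ∀ u v, G.Adj u v ↔ ¬ r u v


namespace DistAux

lemma closed_univ {V : Type*} (G : SimpleGraph V) (hconn : G.Connected) (A : Set V)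
    (a : V) (ha : a ∈ A) (hA : ∀ x ∈ A, ∀ y, G.Adj x y → y ∈ A) (y : V) : y ∈ A := by
  obtain ⟨w⟩ := hconn.preconnected a y
  induction w with
  | nil => exact ha
  | cons h p ih => exact ih (hA _ ha _ h)

lemma twin {V : Type*} {G : SimpleGraph V} {u v x : V} (hu : G.IsSimplicialVertex u)
    (huv : G.Adj u v) (hx : G.Adj u x) (hne : x ≠ v) : G.Adj v x :=
  hu (show v ∈ G.neighborSet u from huv) (show x ∈ G.neighborSet u from hx) hne.symm

lemma simp_iso {V : Type*} {G : SimpleGraph V} (φ : G ≃g G) {v : V}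
    (h : G.IsSimplicialVertex v) : G.IsSimplicialVertex (φ v) := by
  intro a ha b hb hab
  obtain ⟨a, rfl⟩ := φ.surjective a
  obtain ⟨b, rfl⟩ := φ.surjective b
  have ha' : G.Adj v a := φ.map_adj_iff.1 ha
  have hb' : G.Adj v b := φ.map_adj_iff.1 hb
  exact φ.map_adj_iff.2 (h ha' hb' (fun e => hab (by rw [e])))

lemma simp_iso_iff {V : Type*} {G : SimpleGraph V} (φ : G ≃g G) (v : V) :
    G.IsSimplicialVertex (φ v) ↔ G.IsSimplicialVertex v := by
  refine ⟨fun h => ?_, simp_iso φ⟩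
  have := simp_iso φ.symm h
  simpa using this

lemma exists_dist {V : Type*} [Finite V] (G : SimpleGraph V) :
    ∃ c : G.Coloring (Fin G.distChromNum), G.IsDistinguishingColoring c := by
  have : ({k | ∃ c : G.Coloring (Fin k), G.IsDistinguishingColoring c}).Nonempty := by
    obtain ⟨n, ⟨e⟩⟩ := Finite.exists_equiv_fin V
    refine ⟨n, Coloring.mk e (fun {u v} h he => G.ne_of_adj h (e.injective he)), ?_⟩
    intro φ h v
    exact e.injective (h v)
  exact Nat.sInf_mem this

lemma dist_le {V α : Type*} [Fintype α] (G : SimpleGraph V) (f : V → α)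
    (hf : ∀ u v, G.Adj u v → f u ≠ f v)
    (hd : ∀ φ : G ≃g G, (∀ v, f (φ v) = f v) → ∀ v, φ v = v) :
    G.distChromNum ≤ Fintype.card α := by
  apply Nat.sInf_le
  let e := Fintype.equivFin α
  refine ⟨Coloring.mk (fun v => e (f v)) (fun {u v} h he => hf u v h (e.injective he)), ?_⟩
  intro φ h v
  exact hd φ (fun v => e.injective (h v)) v

lemma universal_case {V : Type*} [Fintype V] (G : SimpleGraph V)
    (hu : ∃ v : V, ∀ w : V, w ≠ v → G.Adj v w) :
    G.distChromNum ≤ G.maxDeg ∨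
      (G.IsCompleteMultipartite' ∧ ∃ v : V, ∀ w : V, w ≠ v → G.Adj v w) := by
  classical
  by_cases hm : G.IsCompleteMultipartite'
  · exact Or.inr ⟨hm, hu⟩
  left
  have hex : ∃ u v w, ¬ G.Adj u v ∧ ¬ G.Adj v w ∧ G.Adj u w := by
    by_contra hcon
    push Not at hcon
    refine hm ⟨fun a b => ¬ G.Adj a b, ⟨fun a => G.loopless.irrefl a, fun {a b} h h' => h h'.symm,
      fun {a b c} h1 h2 => hcon a b c h1 h2⟩, fun a b => not_not.symm⟩
  obtain ⟨u, v, w, huv, hvw, huw⟩ := hex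
  have huvne : u ≠ v := by rintro rfl; exact hvw huw
  have hwv : w ≠ v := by rintro rfl; exact huv huw
  have hwu : w ≠ u := huw.ne'
  obtain ⟨x, hx⟩ := hu
  have hcard : Fintype.card {y : V // y ≠ v} ≤ G.maxDeg := by
    have h1 : G.degree x ≤ G.maxDeg := by
      unfold SimpleGraph.maxDeg
      exact G.degree_le_maxDegree x
    refine le_trans ?_ h1
    rw [← G.card_neighborFinset_eq_degree]
    have : Finset.univ.erase x ⊆ G.neighborFinset x := by
      intro y hy
      simp at hy
      simpa using hx y hy
    have := Finset.card_le_card this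
    rw [Finset.card_erase_of_mem (Finset.mem_univ _)] at this
    simpa [Fintype.card_subtype_compl] using this
  refine le_trans (dist_le G (α := {y : V // y ≠ v})
    (fun y => if h : y = v then ⟨u, huvne⟩ else ⟨y, h⟩) ?_ ?_) hcard
  · intro a b hab he
    have := hab.ne
    have := hab.symm
    have huv' : ¬ G.Adj v u := fun h => huv h.symm
    split_ifs at he with h1 h2 h2 <;> simp at he <;> subst_vars <;> grind
  · intro φ h
    have key : ∀ y, φ y = y ∨ (y = u ∧ φ y = v) ∨ (y = v ∧ φ y = u) := by
      intro y
      have := h y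
      split_ifs at this with h1 h2 h2 <;> simp at this <;> grind
    have hw : φ w = w := by
      have := key w
      grind
    have hfu : φ u = u := by
      rcases key u with h1 | ⟨_, h1⟩ | ⟨h1, _⟩
      · exact h1
      · have := φ.map_adj_iff.2 huw
        rw [h1, hw] at this
        exact absurd this hvw
      · exact absurd h1 huvne
    intro y
    rcases key y with h1 | ⟨h1, _⟩ | ⟨h1, h2⟩
    · exact h1
    · rw [h1]; exact hfu
    · exact absurd (φ.injective (h2.trans hfu.symm)) (by rw [h1]; exact huvne.symm)

lemma main_case {V : Type*} [Fintype V] (G : SimpleGraph V)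
    (hconn : G.Connected) (hS : {v : V | G.IsSimplicialVertex v}.Nonempty)
    (hu : ¬ ∃ v : V, ∀ w : V, w ≠ v → G.Adj v w) (k : ℕ) (hk : G.maxDeg ≤ k)
    (hk' : (G.induce {v : V | ¬ G.IsSimplicialVertex v}).distChromNum ≤ k) :
    G.distChromNum ≤ k := by
  classical
  obtain ⟨c0, hc0⟩ := exists_dist (G.induce {v : V | ¬ G.IsSimplicialVertex v})
  let c : {v : V | ¬ G.IsSimplicialVertex v} → Fin k := fun v => Fin.castLE hk' (c0 v)
  have hcinj : ∀ a b, c a = c b → c0 a = c0 b := fun a b h => Fin.castLE_injective hk' h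
  let P : V → Finset {v : V | ¬ G.IsSimplicialVertex v} := fun s =>
    Finset.univ.filter (fun x => G.Adj s x)
  have hP : ∀ s x, x ∈ P s ↔ G.Adj s x := fun s x => by simp [P]
  have hPtwin : ∀ s t, G.IsSimplicialVertex s → G.IsSimplicialVertex t → G.Adj s t →
      P s = P t := by
    intro s t hs ht hst
    ext x
    rw [hP, hP]
    constructor
    · intro h
      exact twin hs hst h (fun e => x.2 (e ▸ ht))
    · intro h
      exact twin ht hst.symm h (fun e => x.2 (e ▸ hs))
  have hPne : ∀ s, G.IsSimplicialVertex s → (P s).Nonempty := by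
    intro s hs
    by_contra hne
    rw [Finset.not_nonempty_iff_eq_empty] at hne
    have hnb : ∀ y, G.Adj s y → G.IsSimplicialVertex y := by
      intro y hy
      by_contra hy'
      have : (⟨y, hy'⟩ : {v : V | ¬ G.IsSimplicialVertex v}) ∈ P s := (hP _ _).2 hy
      rw [hne] at this
      simp at this
    apply hu
    refine ⟨s, fun w hw => ?_⟩
    have := closed_univ G hconn {y | y = s ∨ G.Adj s y} s (Or.inl rfl) (by
      rintro x (rfl | hx) y hy
      · exact Or.inr hy
      · by_cases e : y = s
        · exact Or.inl e
        · exact Or.inr (twin (hnb x hx) hx.symm hy e)) w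
    exact this.resolve_left hw
  let T : Finset {v : V | ¬ G.IsSimplicialVertex v} → Finset V := fun Q =>
    Finset.univ.filter (fun s => G.IsSimplicialVertex s ∧ P s = Q)
  have hT : ∀ Q s, s ∈ T Q ↔ G.IsSimplicialVertex s ∧ P s = Q := fun Q s => by simp [T]
  have hdeg : ∀ x, G.degree x ≤ k := by
    intro x
    refine le_trans ?_ hk
    unfold SimpleGraph.maxDeg
    exact G.degree_le_maxDegree x
  have hcount : ∀ s, G.IsSimplicialVertex s → (T (P s)).card + (P s).card ≤ k := by
    intro s hs
    by_contra hlt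
    push Not at hlt
    let A : Finset V := (P s).map (Function.Embedding.subtype _) ∪ T (P s)
    have hA : ∀ y, y ∈ A ↔ ((∃ h : ¬ G.IsSimplicialVertex y, (⟨y, h⟩ :
        {v : V | ¬ G.IsSimplicialVertex v}) ∈ P s) ∨ y ∈ T (P s)) := by
      intro y
      simp [A]
    have hAcard : A.card = (T (P s)).card + (P s).card := by
      rw [Finset.card_union_of_disjoint, Finset.card_map, add_comm]
      rw [Finset.disjoint_left]
      intro y hy hy'
      rw [Finset.mem_map] at hy
      obtain ⟨z, _, rfl⟩ := hy
      exact z.2 ((hT _ _).1 hy').1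
    have hsub : ∀ x ∈ P s, A.erase x.1 ⊆ G.neighborFinset x.1 := by
      intro x hx y hy
      rw [Finset.mem_erase, hA] at hy
      rw [mem_neighborFinset]
      obtain ⟨hyx, ⟨h, hy⟩ | hy⟩ := hy
      · exact twin hs ((hP _ _).1 hx) ((hP _ _).1 hy) hyx
      · rw [hT] at hy
        rw [← hy.2, hP] at hx
        exact hx.symm
    have hmemA : ∀ x ∈ P s, x.1 ∈ A := fun x hx => (hA _).2 (Or.inl ⟨x.2, hx⟩)
    have heq : ∀ x ∈ P s, A.erase x.1 = G.neighborFinset x.1 := by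
      intro x hx
      apply Finset.eq_of_subset_of_card_le (hsub x hx)
      rw [Finset.card_erase_of_mem (hmemA x hx), G.card_neighborFinset_eq_degree]
      have := hdeg x.1
      omega
    have hall : ∀ y, y ∈ A := by
      refine closed_univ G hconn (A : Set V) s ((hA s).2 (Or.inr ((hT _ _).2 ⟨hs, rfl⟩))) ?_
      intro x hx y hxy
      rcases (hA x).1 hx with ⟨h, hx⟩ | hx
      · have : y ∈ G.neighborFinset x := by simpa using hxy
        rw [← heq _ hx] at this
        exact Finset.mem_of_mem_erase this
      · rw [hT] at hx
        refine (hA y).2 ?_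
        by_cases hy : G.IsSimplicialVertex y
        · right
          rw [hT]
          exact ⟨hy, (hPtwin x y hx.1 hy hxy).symm.trans hx.2⟩
        · left
          exact ⟨hy, hx.2 ▸ (hP _ _).2 hxy⟩
    obtain ⟨x, hx⟩ := hPne s hs
    apply hu
    refine ⟨x, fun w hw => ?_⟩
    have := hsub x hx (Finset.mem_erase.2 ⟨hw, hall w⟩)
    simpa using this
  obtain ⟨s0, hs0⟩ := hS
  obtain ⟨x0, -⟩ := hPne s0 hs0
  have : Nonempty (Fin k) := ⟨c x0⟩
  have hg : ∀ Q, ∃ g : V → Fin k, Set.InjOn g (T Q) ∧ ∀ v ∈ T Q, g v ∉ Q.image c := by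
    intro Q
    have hle : (T Q).card ≤ ((Q.image c)ᶜ).card := by
      rcases (T Q).eq_empty_or_nonempty with h | ⟨s, hs⟩
      · simp [h]
      · rw [hT] at hs
        have h1 := hcount s hs.1
        rw [hs.2] at h1
        have h2 := Finset.card_image_le (s := Q) (f := c)
        rw [Finset.card_compl, Fintype.card_fin]
        omega
    obtain ⟨e⟩ : Nonempty (T Q ↪ ((Q.image c)ᶜ : Finset (Fin k))) :=
      Function.Embedding.nonempty_of_card_le (by rw [Fintype.card_coe, Fintype.card_coe]; exact hle)
    refine ⟨fun v => if h : v ∈ T Q then (e ⟨v, h⟩).1 else Classical.arbitrary _, ?_, ?_⟩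
    · intro a ha b hb hab
      have ha' : a ∈ T Q := ha
      have hb' : b ∈ T Q := hb
      simp only [ha', hb', dif_pos] at hab
      have := e.injective (Subtype.ext hab)
      simpa using this
    · intro v hv
      simp only [hv, dif_pos]
      exact Finset.mem_compl.1 (e ⟨v, hv⟩).2
  choose g hginj hgav using hg
  let f : V → Fin k := fun v => if h : G.IsSimplicialVertex v then g (P v) v else c ⟨v, h⟩
  have fs : ∀ v, G.IsSimplicialVertex v → f v = g (P v) v := fun v h => by simp [f, h]
  have fn : ∀ v (h : ¬ G.IsSimplicialVertex v), f v = c ⟨v, h⟩ := fun v h => by simp [f, h]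
  have hTs : ∀ v, G.IsSimplicialVertex v → v ∈ T (P v) := fun v h => (hT _ _).2 ⟨h, rfl⟩
  have hmix : ∀ u v, G.Adj u v → G.IsSimplicialVertex u → ¬ G.IsSimplicialVertex v →
      f u ≠ f v := by
    intro u v huv h1 h2 he
    rw [fs u h1, fn v h2] at he
    apply hgav (P u) u (hTs u h1)
    rw [he]
    exact Finset.mem_image_of_mem _ ((hP _ _).2 huv)
  have hfin := dist_le G f ?_ ?_
  · simpa using hfin
  · intro u v huv
    by_cases h1 : G.IsSimplicialVertex u <;> by_cases h2 : G.IsSimplicialVertex v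
    · intro he
      have hp := hPtwin u v h1 h2 huv
      rw [fs u h1, fs v h2, ← hp] at he
      exact huv.ne (hginj _ (hTs u h1) (by rw [hp]; exact hTs v h2) he)
    · exact hmix u v huv h1 h2
    · exact (hmix v u huv.symm h2 h1).symm
    · intro he
      rw [fn u h1, fn v h2] at he
      have hadj : (G.induce {v : V | ¬ G.IsSimplicialVertex v}).Adj ⟨u, h1⟩ ⟨v, h2⟩ := huv
      exact c0.valid hadj (hcinj _ _ he)
  · intro φ hφ
    let ψ : (G.induce {v : V | ¬ G.IsSimplicialVertex v}) ≃g
        (G.induce {v : V | ¬ G.IsSimplicialVertex v}) :=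
      { toEquiv := φ.toEquiv.subtypeEquiv (fun v => (not_congr (simp_iso_iff φ v)).symm)
        map_rel_iff' := fun {a b} => φ.map_adj_iff }
    have hψ : ∀ v, ψ v = v := by
      apply hc0 ψ
      intro v
      apply hcinj
      have h2 : ¬ G.IsSimplicialVertex (φ v.1) := (not_congr (simp_iso_iff φ v.1)).2 v.2
      have := hφ v.1
      rw [fn _ v.2, fn _ h2] at this
      exact this
    have hfix : ∀ x : {v : V | ¬ G.IsSimplicialVertex v}, φ x.1 = x.1 := fun x =>
      congrArg Subtype.val (hψ x)
    intro v
    by_cases hv : G.IsSimplicialVertex v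
    · have hv' := simp_iso φ hv
      have hp : P (φ v) = P v := by
        ext x
        rw [hP, hP]
        conv_lhs => rw [← hfix x]
        exact φ.map_adj_iff
      have he := hφ v
      rw [fs _ hv, fs _ hv', hp] at he
      exact hginj _ (by rw [← hp]; exact hTs _ hv') (hTs v hv) he
    · exact hfix ⟨v, hv⟩

end DistAux

theorem statement_3 {V : Type*} [Fintype V] (G : SimpleGraph V)
    (hconn : G.Connected)
    (hS : {v : V | G.IsSimplicialVertex v}.Nonempty)
    (hgt : (G.induce {v : V | ¬ G.IsSimplicialVertex v}).distChromNum < G.distChromNum) :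
    G.distChromNum ≤ G.maxDeg ∨
      (G.IsCompleteMultipartite' ∧ ∃ v : V, ∀ w : V, w ≠ v → G.Adj v w) := by
  by_cases hu : ∃ v : V, ∀ w : V, w ≠ v → G.Adj v w
  · exact DistAux.universal_case G hu
  · left
    have := DistAux.main_case G hconn hS hu _ (le_max_left _ _) (le_max_right _ _)
    rcases le_max_iff.1 this with h | h
    · exact h
    · exact absurd h (not_le.2 hgt)
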